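/- On the free vector space KP with basis the set of all compositions, the box-adding up operator Ũ = Σ_{i≥1} 𝔱_i and the filtered down operator D̃ = Σ_{∅≠I⊂ℕ finite} 𝔡_I satisfy D̃Ũ − ŨD̃ = D̃ + Id. (Equivalently, the left composition poset L_c and the strong filtered graph Q̃_c are dual filtered graphs.) -/

import Mathlib

namespace CompOps

/-- Subtract 1 from the rightmost part equal to `i`; `none` if no part equals `i`. -/
def removeAux (i : ℕ) : List ℕ → Option (List ℕ)
  | [] => none
  | x :: xs =>
    match removeAux i xs with
    | some ys => some (x :: ys)
    | none => if x = i then some ((i - 1) :: xs) else none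

/-- The box removing operator `𝔡ᵢ`, acting on weak compositions together with a
formal zero (`none`); `𝔡₀` is the identity. -/
def d : ℕ → Option (List ℕ) → Option (List ℕ)
  | 0, o => o
  | i + 1, o => o.bind (removeAux (i + 1))

/-- The appending operator `aᵢ`, appending a part `i` at the end. -/
def a (i : ℕ) : Option (List ℕ) → Option (List ℕ) :=
  Option.map (fun l => l ++ [i])

/-- `𝔡_I` for a finite set `I = {i₁ < ⋯ < i_k}`: the composite
`𝔡_{i₁}𝔡_{i₂}⋯𝔡_{i_k}`, where `𝔡_{i_k}` (the largest index) acts first. -/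
def dSet (I : Finset ℕ) : Option (List ℕ) → Option (List ℕ) :=
  (I.sort (· ≤ ·)).foldr (fun i f => d i ∘ f) id

/-- The jdt operator `𝔲ᵢ = aᵢ 𝔡_{[i-1]}` (with `𝔲₀` the identity). -/
def u : ℕ → Option (List ℕ) → Option (List ℕ)
  | 0 => id
  | i + 1 => a (i + 1) ∘ dSet (Finset.Icc 1 i)

/-- Add 1 to the leftmost part equal to `j`; `none` if no part equals `j`. -/
def addAux (j : ℕ) : List ℕ → Option (List ℕ)
  | [] => none
  | x :: xs => if x = j then some ((x + 1) :: xs) else (addAux j xs).map (x :: ·)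

/-- The box adding operator `𝔱ᵢ`: `𝔱₁` prepends a part 1, and for `i ≥ 2`, `𝔱ᵢ`
adds 1 to the leftmost part equal to `i - 1` (formal zero if there is none). -/
def t : ℕ → Option (List ℕ) → Option (List ℕ)
  | 0 => id
  | 1 => Option.map (fun l => 1 :: l)
  | i + 2 => fun o => o.bind (addAux (i + 1))

/-- Compositions: finite lists of positive integers. -/
abbrev Comp := {l : List ℕ // ∀ x ∈ l, 0 < x}

/-- Send a weak composition (or the formal zero `none`) to the basis vector of `KP`
(with `K = ℚ`) indexed by its underlying composition (or to `0`), as a linear map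
from the coefficient field. -/
noncomputable def sgl : Option (List ℕ) → (ℚ →ₗ[ℚ] (Comp →₀ ℚ))
  | none => 0
  | some l =>
    Finsupp.lsingle ⟨l.filter (fun x => 0 < x), fun x hx => by
      simp only [List.mem_filter, decide_eq_true_eq] at hx
      exact hx.2⟩

/-- The linear endomorphism of `KP` given by the (pointwise finitely supported)
sum `Σ_{i ≥ 1} F i` of a family of operators on weak compositions. -/
noncomputable def sumOp (F : ℕ → Option (List ℕ) → Option (List ℕ)) :
    (Comp →₀ ℚ) →ₗ[ℚ] (Comp →₀ ℚ) :=
  Finsupp.lsum ℚ fun c => ∑ᶠ i ∈ Set.Ici (1 : ℕ), sgl (F i (some c.1))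

/-- The filtered down operator `D̃ = Σ_{∅ ≠ I ⊂ ℕ finite} 𝔡_I` as a linear
endomorphism of `KP`. -/
noncomputable def filteredD : (Comp →₀ ℚ) →ₗ[ℚ] (Comp →₀ ℚ) :=
  Finsupp.lsum ℚ fun c =>
    ∑ᶠ I ∈ {I : Finset ℕ | I.Nonempty ∧ ∀ j ∈ I, 0 < j}, sgl (dSet I (some c.1))

theorem removeAux_eq_none_iff {i : ℕ} {l : List ℕ} : removeAux i l = none ↔ i ∉ l := by
  induction l with
  | nil => simp [removeAux]
  | cons x xs ih => simp only [removeAux]; grind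

theorem addAux_eq_none_iff {i : ℕ} {l : List ℕ} : addAux i l = none ↔ i ∉ l := by
  induction l with
  | nil => simp [addAux]
  | cons x xs ih => cases h : addAux i xs <;> simp only [addAux, h] <;> grind

theorem removeAux_cons (i x : ℕ) (xs : List ℕ) :
    removeAux i (x :: xs) = if i ∈ xs then (removeAux i xs).map (x :: ·)
      else if x = i then some ((i - 1) :: xs) else none := by
  have h := removeAux_eq_none_iff (i := i) (l := xs)
  rw [removeAux]
  cases hx : removeAux i xs <;> simp_all

theorem lt_of_mem_removeAux {i m : ℕ} {l l' : List ℕ} (h : removeAux i l = some l')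
    (hl : ∀ x ∈ l, x < m) : ∀ x ∈ l', x < m := by
  induction l generalizing l' with
  | nil => simp [removeAux] at h
  | cons y ys ih =>
    have hy := hl y List.mem_cons_self
    have hys : ∀ x ∈ ys, x < m := fun x hx => hl x (List.mem_cons_of_mem y hx)
    cases h' : removeAux i ys <;> simp only [removeAux, h'] at h <;> grind

theorem lt_of_mem_addAux {i m : ℕ} {l l' : List ℕ} (h : addAux i l = some l')
    (hl : ∀ x ∈ l, x < m) : ∀ x ∈ l', x < m + 1 := by
  induction l generalizing l' with
  | nil => simp [addAux] at h
  | cons y ys ih =>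
    have hy := hl y List.mem_cons_self
    have hys : ∀ x ∈ ys, x < m := fun x hx => hl x (List.mem_cons_of_mem y hx)
    cases h' : addAux i ys <;> simp only [addAux, h'] at h <;> grind

theorem mem_addAux_of_ne {i j : ℕ} {l l' : List ℕ} (h : addAux i l = some l') (hj : j ∈ l)
    (hij : j ≠ i) : j ∈ l' := by
  induction l generalizing l' with
  | nil => simp at hj
  | cons y ys ih => cases h' : addAux i ys <;> simp only [addAux, h'] at h <;> grind

/-- The parts that survive passing to the underlying composition. -/
abbrev posParts (l : List ℕ) : List ℕ := l.filter (fun x => 0 < x)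

theorem removeAux_posParts (i : ℕ) (l : List ℕ) :
    (removeAux (i + 1) (posParts l)).map posParts = (removeAux (i + 1) l).map posParts := by
  induction l with
  | nil => rfl
  | cons x xs ih =>
    have h1 := removeAux_eq_none_iff (i := i + 1) (l := xs)
    have h2 := removeAux_eq_none_iff (i := i + 1) (l := posParts xs)
    rcases Nat.eq_zero_or_pos x with rfl | hx
    · simp only [posParts, removeAux] at *
      cases h : removeAux (i + 1) xs <;> simp_all
    · simp only [posParts, hx, decide_true, List.filter_cons_of_pos, removeAux] at *
      cases h : removeAux (i + 1) xs <;>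
        cases h' : removeAux (i + 1) (xs.filter (fun x => 0 < x)) <;>
        simp_all [List.filter_cons]

theorem addAux_posParts (i : ℕ) (l : List ℕ) :
    (addAux (i + 1) (posParts l)).map posParts = (addAux (i + 1) l).map posParts := by
  induction l with
  | nil => rfl
  | cons x xs ih =>
    rcases Nat.eq_zero_or_pos x with rfl | hx
    · simp only [posParts, addAux] at *
      cases h : addAux (i + 1) xs <;> simp_all
    · simp only [posParts, hx, decide_true, List.filter_cons_of_pos, addAux] at *
      split_ifs
      · simp
      · cases h : addAux (i + 1) xs <;>
          cases h' : addAux (i + 1) (xs.filter (fun x => 0 < x)) <;>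
          simp_all [List.filter_cons]

theorem removeAux_addAux_comm {i j : ℕ} (hi : 0 < i) (hij : j ≠ i + 1) (l : List ℕ) :
    (addAux i l).bind (removeAux j) = (removeAux j l).bind (addAux i) := by
  induction l with
  | nil => rfl
  | cons x xs ih =>
    have hr := removeAux_eq_none_iff (i := j) (l := xs)
    have ha := addAux_eq_none_iff (i := i) (l := xs)
    have hm (zs : List ℕ) (hz : addAux i xs = some zs) (hj : j ∈ xs) (hji : j ≠ i) :
        removeAux j zs ≠ none :=
      fun h => removeAux_eq_none_iff.1 h (mem_addAux_of_ne hz hj hji)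
    simp only [addAux, removeAux]
    cases h : removeAux j xs <;> cases h' : addAux i xs <;>
      simp_all only [Option.bind_some, Option.bind_none] <;>
      split_ifs <;> simp_all [removeAux, addAux] <;> grind [addAux, removeAux]

theorem removeAux_addAux_of_not_mem {i : ℕ} {l : List ℕ} (h : i ∈ l) (h' : i + 1 ∉ l) :
    (addAux i l).bind (removeAux (i + 1)) = some l := by
  induction l with
  | nil => simp at h
  | cons x xs ih =>
    have hr := removeAux_eq_none_iff (i := i + 1) (l := xs)
    have ha := addAux_eq_none_iff (i := i) (l := xs)
    rw [addAux]
    cases h'' : addAux i xs <;> split_ifs <;> grind [removeAux]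

theorem addAux_removeAux_of_not_mem {i : ℕ} {l : List ℕ} (h : i ∉ l) (h' : i + 1 ∈ l) :
    (removeAux (i + 1) l).bind (addAux i) = some l := by
  induction l with
  | nil => simp at h'
  | cons x xs ih =>
    rw [removeAux_cons]
    split_ifs <;> cases h'' : removeAux (i + 1) xs <;> grind [addAux]

theorem removeAux_addAux_of_mem {i : ℕ} {l : List ℕ} (h : i ∈ l) (h' : i + 1 ∈ l) :
    (addAux i l).bind (removeAux (i + 1)) = (removeAux (i + 1) l).bind (addAux i) := by
  induction l with
  | nil => simp at h
  | cons x xs ih =>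
    have hr := removeAux_eq_none_iff (i := i + 1) (l := xs)
    have ha := addAux_eq_none_iff (i := i) (l := xs)
    have hA := removeAux_addAux_of_not_mem (i := i) (l := xs)
    have hm (zs : List ℕ) (hz : addAux i xs = some zs) (hj : i + 1 ∈ xs) :
        removeAux (i + 1) zs ≠ none :=
      fun h => removeAux_eq_none_iff.1 h (mem_addAux_of_ne hz hj (by omega))
    rw [addAux, removeAux_cons]
    cases h1 : addAux i xs <;> cases h2 : removeAux (i + 1) xs <;>
      simp only [h1, h2, Option.bind_some, Option.bind_none, Option.map_some, Option.map_none]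
        at ih hA ⊢ <;> split_ifs <;>
      simp only [Option.bind_some, Option.bind_none, removeAux, addAux] <;> grind [addAux]

/-- The vector of `KP` represented by a weak composition or by the formal zero. -/
noncomputable abbrev vec (o : Option (List ℕ)) : Comp →₀ ℚ := sgl o 1

theorem vec_none : vec none = 0 := rfl

theorem vec_eq_of_map_posParts_eq {o o' : Option (List ℕ)}
    (h : o.map posParts = o'.map posParts) : vec o = vec o' := by
  cases o <;> cases o' <;> simp_all [vec, sgl]

theorem posParts_coe (c : Comp) : posParts c.1 = c.1 :=
  List.filter_eq_self.2 fun x hx => by simpa using c.2 x hx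

theorem vec_coe (c : Comp) : vec (some c.1) = Finsupp.single c 1 := by
  simp only [vec, sgl, Finsupp.lsingle_apply]
  congr 1
  exact Subtype.ext (posParts_coe c)

theorem vec_posParts (l : List ℕ) : vec (some (posParts l)) = vec (some l) :=
  vec_eq_of_map_posParts_eq (by simp [posParts])

/-- Linear maps out of `KP` agree once they agree on compositions. -/
theorem hom_ext_vec {f g : (Comp →₀ ℚ) →ₗ[ℚ] (Comp →₀ ℚ)}
    (h : ∀ c : Comp, f (vec (some c.1)) = g (vec (some c.1))) : f = g := by
  refine Finsupp.lhom_ext' fun c => LinearMap.ext_ring ?_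
  simpa [vec_coe] using h c

/-- The linear endomorphism of `KP` induced by an operator on weak compositions. -/
noncomputable def lin (f : Option (List ℕ) → Option (List ℕ)) :
    (Comp →₀ ℚ) →ₗ[ℚ] (Comp →₀ ℚ) :=
  Finsupp.lsum ℚ fun c => sgl (f (some c.1))

theorem lsum_vec (φ : Comp → ℚ →ₗ[ℚ] (Comp →₀ ℚ)) (c : Comp) :
    Finsupp.lsum ℚ φ (vec (some c.1)) = φ c 1 := by
  rw [vec_coe]
  simp

theorem lin_vec_some {f : Option (List ℕ) → Option (List ℕ)} (l : List ℕ)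
    (h : (f (some (posParts l))).map posParts = (f (some l)).map posParts) :
    lin f (vec (some l)) = vec (f (some l)) := by
  rw [← vec_posParts l]
  have := lsum_vec (fun c => sgl (f (some c.1))) ⟨posParts l, by simp [posParts]⟩
  exact this.trans (vec_eq_of_map_posParts_eq h)

theorem lin_d_vec (i : ℕ) (o : Option (List ℕ)) :
    lin (d (i + 1)) (vec o) = vec (d (i + 1) o) := by
  cases o with
  | none => simp [d, vec_none]
  | some l => exact lin_vec_some l (removeAux_posParts i l)

theorem lin_t_vec (i : ℕ) (o : Option (List ℕ)) :
    lin (t (i + 1)) (vec o) = vec (t (i + 1) o) := by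
  cases o with
  | none => cases i <;> simp [t, vec_none]
  | some l =>
    refine lin_vec_some l ?_
    cases i with
    | zero => simp [t, posParts]
    | succ i => exact addAux_posParts i l

theorem t_eq_none {i m : ℕ} {l : List ℕ} (hl : ∀ x ∈ l, x < m) (hm : 0 < m) (hi : m ≤ i) :
    t (i + 1) (some l) = none := by
  obtain ⟨i, rfl⟩ : ∃ k, i = k + 1 := ⟨i - 1, by omega⟩
  exact addAux_eq_none_iff.2 fun h => by have := hl _ h; omega

theorem sumOp_t_vec_some {m : ℕ} {l : List ℕ} (hl : ∀ x ∈ l, x < m) (hm : 0 < m) :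
    sumOp t (vec (some l)) = ∑ i ∈ Finset.range m, vec (t (i + 1) (some l)) := by
  have hp : ∀ x ∈ posParts l, x < m := fun x hx => hl x (List.mem_of_mem_filter hx)
  have key : ∑ᶠ i ∈ Set.Ici (1 : ℕ), sgl (t i (some (posParts l)))
      = ∑ i ∈ Finset.Ico 1 (m + 1), sgl (t i (some (posParts l))) := by
    refine finsum_mem_eq_sum_of_inter_support_eq _ (Set.ext fun i => ?_)
    simp only [Set.mem_inter_iff, Set.mem_Ici, Function.mem_support, Finset.coe_Ico, Set.mem_Ico]
    refine ⟨fun ⟨h1, h2⟩ => ⟨⟨h1, ?_⟩, h2⟩, fun ⟨⟨h1, _⟩, h2⟩ => ⟨h1, h2⟩⟩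
    by_contra h
    obtain ⟨i, rfl⟩ : ∃ k, i = k + 1 := ⟨i - 1, by omega⟩
    exact h2 (by rw [t_eq_none hp hm (by omega)]; rfl)
  rw [← vec_posParts l]
  have := lsum_vec (fun c => ∑ᶠ i ∈ Set.Ici (1 : ℕ), sgl (t i (some c.1)))
    ⟨posParts l, by simp [posParts]⟩
  refine this.trans ?_
  rw [key, LinearMap.sum_apply, Finset.sum_Ico_eq_sum_range]
  refine Finset.sum_congr (by simp) fun i _ => ?_
  rw [add_comm 1 i]
  exact (lin_t_vec i _).symm.trans (by rw [vec_posParts, lin_t_vec])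

theorem sumOp_t_vec {m : ℕ} {o : Option (List ℕ)} (ho : ∀ l ∈ o, ∀ x ∈ l, x < m) (hm : 0 < m) :
    sumOp t (vec o) = ∑ i ∈ Finset.range m, vec (t (i + 1) o) := by
  cases o with
  | none => simp only [← lin_t_vec, vec_none, map_zero, Finset.sum_const_zero]
  | some l => exact sumOp_t_vec_some (ho l rfl) hm

open Classical in
/-- The projection of `KP` onto the span of the compositions with a part equal to `n`
(every composition is considered to have a part `0`). -/
noncomputable def hasPart (n : ℕ) : (Comp →₀ ℚ) →ₗ[ℚ] (Comp →₀ ℚ) :=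
  Finsupp.lsum ℚ fun c => if n = 0 ∨ n ∈ c.1 then Finsupp.lsingle c else 0

open Classical in
theorem hasPart_vec (n : ℕ) (l : List ℕ) :
    hasPart n (vec (some l)) = if n = 0 ∨ n ∈ l then vec (some l) else 0 := by
  have hiff : (n = 0 ∨ n ∈ posParts l) ↔ (n = 0 ∨ n ∈ l) := by
    rcases Nat.eq_zero_or_pos n with rfl | hn <;> simp [posParts, *]
  rw [← vec_posParts l]
  refine (lsum_vec _ ⟨posParts l, by simp [posParts]⟩).trans ?_
  simp only [hiff]
  split_ifs
  · exact (vec_coe ⟨posParts l, _⟩).symm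
  · rfl

theorem hasPart_zero : hasPart 0 = LinearMap.id :=
  hom_ext_vec fun c => by simp [hasPart_vec]

theorem d_t_sub_t_d_of_ne {i n : ℕ} (h : i ≠ n) (l : List ℕ) :
    vec (d (n + 1) (t (i + 1) (some l))) - vec (t (i + 1) (d (n + 1) (some l))) = 0 := by
  rw [sub_eq_zero]
  cases i with
  | zero =>
    congr 2
    simp only [t, d, Option.map_some, Option.bind_some, removeAux]
    cases removeAux (n + 1) l <;> simp [h.symm]
  | succ i => exact congrArg vec (removeAux_addAux_comm i.succ_pos (by omega) l)

theorem d_t_sub_t_d_self (n : ℕ) (l : List ℕ) :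
    vec (d (n + 1) (t (n + 1) (some l))) - vec (t (n + 1) (d (n + 1) (some l)))
      = hasPart n (vec (some l)) - hasPart (n + 1) (vec (some l)) := by
  rw [hasPart_vec, hasPart_vec]
  cases n with
  | zero =>
    have hr := removeAux_eq_none_iff (i := 1) (l := l)
    have h0 : vec (some (0 :: l)) = vec (some l) :=
      vec_eq_of_map_posParts_eq (by simp [posParts])
    simp only [t, d, Option.map_some, Option.bind_some, removeAux]
    cases h : removeAux 1 l <;> simp_all [vec_none]
  | succ n =>
    simp only [t, d, Option.bind_some]
    by_cases h : n + 1 ∈ l <;> by_cases h' : n + 1 + 1 ∈ l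
    · simp [h, h', removeAux_addAux_of_mem h h']
    · simp [h, h', removeAux_addAux_of_not_mem h h', removeAux_eq_none_iff.2 h', vec_none]
    · simp [h, h', addAux_removeAux_of_not_mem h h', addAux_eq_none_iff.2 h, vec_none]
    · simp [h, h', removeAux_eq_none_iff.2 h', addAux_eq_none_iff.2 h]

theorem lin_d_sumOp_t_sub (n : ℕ) :
    lin (d (n + 1)) * sumOp t - sumOp t * lin (d (n + 1)) = hasPart n - hasPart (n + 1) := by
  refine hom_ext_vec fun c => ?_
  obtain ⟨l, -⟩ := c
  obtain ⟨m, hm, hl⟩ : ∃ m, n < m ∧ ∀ x ∈ l, x < m :=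
    ⟨l.sum + n + 1, by omega, fun x hx => by have := List.le_sum_of_mem hx; omega⟩
  have hd : ∀ l' ∈ d (n + 1) (some l), ∀ x ∈ l', x < m := fun l' h' =>
    lt_of_mem_removeAux h' hl
  simp only [LinearMap.sub_apply, Module.End.mul_apply]
  rw [lin_d_vec, sumOp_t_vec hd (by omega), sumOp_t_vec_some hl (by omega), map_sum,
    ← Finset.sum_sub_distrib, Finset.sum_eq_single n, lin_d_vec, d_t_sub_t_d_self]
  · intro i _ hi
    rw [lin_d_vec, d_t_sub_t_d_of_ne hi]
  · simp [hm]

theorem hasPart_mul_lin_d (n : ℕ) : hasPart n * lin (d (n + 1)) = lin (d (n + 1)) := by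
  refine hom_ext_vec fun c => ?_
  rw [Module.End.mul_apply, lin_d_vec]
  cases h : d (n + 1) (some c.1) with
  | none => simp [vec_none]
  | some l =>
    have hn : n ∈ l := by
      change removeAux (n + 1) c.1 = some l at h
      generalize c.1 = l' at h
      induction l' generalizing l with
      | nil => simp [removeAux] at h
      | cons x xs ih => rw [removeAux] at h; grind
    simp [hasPart_vec, hn]

theorem lin_d_mul_hasPart (n : ℕ) : lin (d (n + 1)) * hasPart (n + 1) = lin (d (n + 1)) := by
  refine hom_ext_vec fun c => ?_
  rw [Module.End.mul_apply, hasPart_vec]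
  by_cases h : n + 1 = 0 ∨ n + 1 ∈ c.1
  · rw [if_pos h]
  · rw [if_neg h, lin_d_vec, map_zero, d, Option.bind_some,
      removeAux_eq_none_iff.2 (by simpa using h), vec_none]

/-- The ordered product `(1 + 𝔡₁)(1 + 𝔡₂)⋯(1 + 𝔡ₙ)` acting on `KP`. -/
noncomputable def dProd : ℕ → Module.End ℚ (Comp →₀ ℚ)
  | 0 => 1
  | n + 1 => dProd n * (1 + lin (d (n + 1)))

theorem mul_one_add_commutator {R : Type*} [Ring R] {F U x P Q : R}
    (hF : F * U - U * F = F * (1 - P)) (hx : x * U - U * x = P - Q) (hP : P * x = x)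
    (hQ : x * Q = x) : F * (1 + x) * U - U * (F * (1 + x)) = F * (1 + x) * (1 - Q) := by
  calc F * (1 + x) * U - U * (F * (1 + x))
      = F * (x * U - U * x) + (F * U - U * F) * (1 + x) := by
        simp only [mul_add, add_mul, mul_sub, sub_mul, mul_one, mul_assoc]
        abel
    _ = F * (1 - Q) + F * (x - P * x) := by
        rw [hx, hF]
        simp only [mul_add, mul_sub, sub_mul, mul_one, mul_assoc]
        abel
    _ = F * (1 - Q) + F * (x - x * Q) := by rw [hP, hQ]
    _ = F * (1 + x) * (1 - Q) := by
        simp only [mul_add, add_mul, mul_sub, mul_one, mul_assoc]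
        abel

theorem dProd_sumOp_t_sub (n : ℕ) :
    dProd n * sumOp t - sumOp t * dProd n = dProd n * (1 - hasPart n) := by
  induction n with
  | zero =>
    have h : hasPart 0 = 1 := hasPart_zero
    simp [dProd, h]
  | succ n ih =>
    exact mul_one_add_commutator ih (lin_d_sumOp_t_sub n) (hasPart_mul_lin_d n)
      (lin_d_mul_hasPart n)

theorem foldr_d_append (L L' : List ℕ) (o : Option (List ℕ)) :
    (L ++ L').foldr (fun i f => d i ∘ f) id o
      = L.foldr (fun i f => d i ∘ f) id (L'.foldr (fun i f => d i ∘ f) id o) := by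
  induction L with
  | nil => rfl
  | cons x xs ih => exact congrArg (d x) ih

theorem dSet_insert {I : Finset ℕ} {n : ℕ} (h : ∀ j ∈ I, j < n) (o : Option (List ℕ)) :
    dSet (insert n I) o = dSet I (d n o) := by
  have hs : (insert n I).sort (· ≤ ·) = I.sort (· ≤ ·) ++ [n] := by
    refine List.Perm.eq_of_pairwise' (r := (· ≤ ·)) (Finset.pairwise_sort _ _) ?_ ?_
    · rw [List.pairwise_append]
      refine ⟨Finset.pairwise_sort _ _, List.pairwise_singleton _ _, ?_⟩
      simpa using fun a ha => (h a ha).le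
    · refine (Finset.sort_perm_toList _ _).trans ((Finset.toList_insert ?_).trans ?_)
      · exact fun hn => (h n hn).false
      · exact (List.perm_append_singleton _ _).symm.trans
          ((Finset.sort_perm_toList _ _).symm.append_right _)
  rw [dSet, hs, foldr_d_append]
  rfl

theorem d_none (i : ℕ) : d i none = none := by cases i <;> rfl

theorem dSet_none (I : Finset ℕ) : dSet I none = none := by
  unfold dSet
  induction I.sort (· ≤ ·) with
  | nil => rfl
  | cons x xs ih => simp [ih, d_none]

theorem dProd_vec (n : ℕ) (o : Option (List ℕ)) :
    dProd n (vec o) = ∑ I ∈ (Finset.Icc 1 n).powerset, vec (dSet I o) := by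
  induction n generalizing o with
  | zero => simp [dProd, dSet]
  | succ n ih =>
    rw [← Finset.insert_Icc_right_eq_Icc_add_one (by omega), Finset.sum_powerset_insert (by simp)]
    simp only [dProd, Module.End.mul_apply, LinearMap.add_apply, Module.End.one_apply, map_add,
      lin_d_vec, ih]
    congr 1
    refine Finset.sum_congr rfl fun I hI => ?_
    rw [dSet_insert fun j hj => ?_]
    have := Finset.mem_powerset.1 hI hj
    simp at this
    omega

theorem dSet_eq_none {I : Finset ℕ} {n j : ℕ} {l : List ℕ} (hl : ∀ x ∈ l, x ≤ n) (hj : j ∈ I)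
    (hn : n < j) : dSet I (some l) = none := by
  have hI : I.Nonempty := ⟨j, hj⟩
  have hmax : n < I.max' hI := hn.trans_le (I.le_max' j hj)
  rw [← Finset.insert_erase (I.max'_mem hI),
    dSet_insert fun k hk => I.lt_max'_of_mem_erase_max' hI hk]
  obtain ⟨k, hk⟩ : ∃ k, I.max' hI = k + 1 := ⟨I.max' hI - 1, by omega⟩
  rw [hk, d, Option.bind_some, removeAux_eq_none_iff.2, dSet_none]
  exact fun h => by have := hl _ h; omega

theorem filteredD_vec_coe {n : ℕ} (c : Comp) (hc : ∀ x ∈ c.1, x ≤ n) :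
    filteredD (vec (some c.1)) = dProd n (vec (some c.1)) - vec (some c.1) := by
  refine (lsum_vec _ c).trans ?_
  have key : ∑ᶠ I ∈ {I : Finset ℕ | I.Nonempty ∧ ∀ j ∈ I, 0 < j}, sgl (dSet I (some c.1))
      = ∑ I ∈ (Finset.Icc 1 n).powerset.erase ∅, sgl (dSet I (some c.1)) := by
    refine finsum_mem_eq_sum_of_inter_support_eq _ (Set.ext fun I => ?_)
    simp only [Set.mem_inter_iff, Set.mem_ofPred_eq, Function.mem_support, Finset.mem_coe,
      Finset.mem_erase, Finset.mem_powerset, Finset.nonempty_iff_ne_empty]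
    refine ⟨fun ⟨⟨h1, h2⟩, h3⟩ => ⟨⟨h1, fun j hj => ?_⟩, h3⟩,
      fun ⟨⟨h1, h2⟩, h3⟩ => ⟨⟨h1, fun j hj => (Finset.mem_Icc.1 (h2 hj)).1⟩, h3⟩⟩
    refine Finset.mem_Icc.2 ⟨h2 j hj, ?_⟩
    by_contra h
    exact h3 (by rw [dSet_eq_none hc hj (by omega)]; rfl)
  rw [key, dProd_vec, LinearMap.sum_apply, ← Finset.sum_erase_add _ _ (Finset.empty_mem_powerset _)]
  simp [dSet]

theorem filteredD_vec {n : ℕ} {o : Option (List ℕ)} (ho : ∀ l ∈ o, ∀ x ∈ l, x ≤ n) :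
    filteredD (vec o) = dProd n (vec o) - vec o := by
  cases o with
  | none => simp [vec_none]
  | some l =>
    rw [← vec_posParts l]
    exact filteredD_vec_coe ⟨posParts l, by simp [posParts]⟩
      fun x hx => ho l rfl x (List.mem_of_mem_filter hx)

theorem lt_of_mem_t {i m : ℕ} {l : List ℕ} (hl : ∀ x ∈ l, x < m) (hm : 0 < m) :
    ∀ l' ∈ t (i + 1) (some l), ∀ x ∈ l', x < m + 1 := by
  intro l' hl'
  cases i with
  | zero =>
    simp only [t, Option.map_some, Option.mem_def, Option.some.injEq] at hl'
    subst hl'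
    intro x hx
    rcases List.mem_cons.1 hx with rfl | hx
    · omega
    · exact (hl x hx).trans m.lt_succ_self
  | succ i => exact lt_of_mem_addAux hl' hl

/-- Theorem 3.11: the left composition poset `L_c` and the strong filtered graph
`Q̃_c` are dual filtered graphs: with `Ũ = Σ_{i≥1} 𝔱ᵢ` and `D̃ = Σ_{∅≠I⊂ℕ} 𝔡_I`
acting on the free vector space on compositions, `D̃Ũ - ŨD̃ = D̃ + Id`. -/
theorem LcQct_dual_filtered :
    filteredD.comp (sumOp t) - (sumOp t).comp filteredD = filteredD + LinearMap.id := by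
  refine hom_ext_vec fun c => ?_
  obtain ⟨m, hm, hl⟩ : ∃ m, 0 < m ∧ ∀ x ∈ c.1, x < m :=
    ⟨c.1.sum + 1, by omega, fun x hx => by have := List.le_sum_of_mem hx; omega⟩
  have hD : filteredD (vec (some c.1)) = dProd m (vec (some c.1)) - vec (some c.1) :=
    filteredD_vec_coe c fun x hx => (hl x hx).le
  have hDU : filteredD (sumOp t (vec (some c.1)))
      = dProd m (sumOp t (vec (some c.1))) - sumOp t (vec (some c.1)) := by
    rw [sumOp_t_vec_some hl hm, map_sum, map_sum, ← Finset.sum_sub_distrib]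
    exact Finset.sum_congr rfl fun i _ => filteredD_vec fun l' hl' x hx =>
      Nat.le_of_lt_succ (lt_of_mem_t hl hm l' hl' x hx)
  have hP : hasPart m (vec (some c.1)) = 0 := by
    rw [hasPart_vec, if_neg]
    rintro (h | h)
    · omega
    · exact (hl m h).false
  have key := LinearMap.congr_fun (dProd_sumOp_t_sub m) (vec (some c.1))
  simp only [LinearMap.sub_apply, Module.End.mul_apply, Module.End.one_apply, hP, sub_zero] at key
  simp only [LinearMap.sub_apply, LinearMap.add_apply, LinearMap.comp_apply, LinearMap.id_apply]
  rw [hDU, hD, map_sub, sub_add_cancel, sub_sub_sub_cancel_right, key]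

end CompOps
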